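/- Every maximal finite subgroup of O(1,2)(ℤ) is conjugate in O(1,2)(ℤ) to one of the two subgroups ⟨Ref_{E₁−E₂}, Ref_{E₂}, −I₃⟩ or ⟨Ref_{H−E₁−E₂}, Ref_{E₁−E₂}, −I₃⟩. -/

import Mathlib

open Matrix

/-- The symmetric bilinear form `Q(x,y) = x₀y₀ − x₁y₁ − x₂y₂` on `ℤ³`. -/
def Q3 (x y : Fin 3 → ℤ) : ℤ := x 0 * y 0 - x 1 * y 1 - x 2 * y 2

/-- The Gram matrix `J = diag(1,−1,−1)` of `Q3`. -/
def J3 : Matrix (Fin 3) (Fin 3) ℤ := Matrix.diagonal ![1, -1, -1]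

/-- The matrix of the reflection `w ↦ w − (2·Q(v,w)/Q(v,v))·v` about `v`. -/
def reflMat3 (v : Fin 3 → ℤ) : Matrix (Fin 3) (Fin 3) ℤ :=
  Matrix.of fun i j => (if i = j then 1 else 0) - 2 * Q3 v (Pi.single j 1) / Q3 v v * v i

/-- `Ref_{H−E₁−E₂}` as an element of `GL(3,ℤ)`. -/
def refHE1E2 : (Matrix (Fin 3) (Fin 3) ℤ)ˣ :=
  ⟨reflMat3 ![1, -1, -1], reflMat3 ![1, -1, -1], by decide, by decide⟩

/-- `Ref_{E₁−E₂}` as an element of `GL(3,ℤ)`. -/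
def refE1E2 : (Matrix (Fin 3) (Fin 3) ℤ)ˣ :=
  ⟨reflMat3 ![0, 1, -1], reflMat3 ![0, 1, -1], by decide, by decide⟩

/-- `Ref_{E₂}` as an element of `GL(3,ℤ)`. -/
def refE2 : (Matrix (Fin 3) (Fin 3) ℤ)ˣ :=
  ⟨reflMat3 ![0, 0, 1], reflMat3 ![0, 0, 1], by decide, by decide⟩

/-- The set `O⁺(2,1)(ℤ)` of elements of `GL(3,ℤ)` preserving `J` and with positive
`(0,0)` entry. -/
def Oplus21 : Set (Matrix (Fin 3) (Fin 3) ℤ)ˣ :=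
  {A | (A : Matrix (Fin 3) (Fin 3) ℤ)ᵀ * J3 * (A : Matrix (Fin 3) (Fin 3) ℤ) = J3 ∧
    0 < (A : Matrix (Fin 3) (Fin 3) ℤ) 0 0}

/-- The set `O(1,2)(ℤ)` of elements of `GL(3,ℤ)` preserving `J`. -/
def O12 : Set (Matrix (Fin 3) (Fin 3) ℤ)ˣ :=
  {A | (A : Matrix (Fin 3) (Fin 3) ℤ)ᵀ * J3 * (A : Matrix (Fin 3) (Fin 3) ℤ) = J3}


lemma o12_entries {A : (Matrix (Fin 3) (Fin 3) ℤ)ˣ} (h : A ∈ O12) (i j : Fin 3) :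
    A.1 0 i * A.1 0 j - A.1 1 i * A.1 1 j - A.1 2 i * A.1 2 j = J3 i j := by
  have h' : (A : Matrix (Fin 3) (Fin 3) ℤ)ᵀ * J3 * (A : Matrix (Fin 3) (Fin 3) ℤ) = J3 := h
  have := congrFun (congrFun h' i) j
  rw [← this]
  simp [Matrix.mul_apply, Fin.sum_univ_three, J3, Matrix.diagonal]
  ring

lemma o12_one : (1 : (Matrix (Fin 3) (Fin 3) ℤ)ˣ) ∈ O12 := by
  simp [O12]

lemma o12_mul {A B : (Matrix (Fin 3) (Fin 3) ℤ)ˣ} (hA : A ∈ O12) (hB : B ∈ O12) :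
    A * B ∈ O12 := by
  have hA' : (A : Matrix (Fin 3) (Fin 3) ℤ)ᵀ * J3 * (A : Matrix (Fin 3) (Fin 3) ℤ) = J3 := hA
  have hB' : (B : Matrix (Fin 3) (Fin 3) ℤ)ᵀ * J3 * (B : Matrix (Fin 3) (Fin 3) ℤ) = J3 := hB
  change ((A * B : (Matrix (Fin 3) (Fin 3) ℤ)ˣ) : Matrix (Fin 3) (Fin 3) ℤ)ᵀ * J3 * _ = J3
  rw [Units.val_mul, Matrix.transpose_mul]
  calc (B.1)ᵀ * (A.1)ᵀ * J3 * (A.1 * B.1) = (B.1)ᵀ * ((A.1)ᵀ * J3 * A.1) * B.1 := by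
        simp only [Matrix.mul_assoc]
    _ = J3 := by rw [hA', hB']

lemma o12_inv {A : (Matrix (Fin 3) (Fin 3) ℤ)ˣ} (hA : A ∈ O12) : A⁻¹ ∈ O12 := by
  have hA' : (A : Matrix (Fin 3) (Fin 3) ℤ)ᵀ * J3 * (A : Matrix (Fin 3) (Fin 3) ℤ) = J3 := hA
  change ((A⁻¹ : (Matrix (Fin 3) (Fin 3) ℤ)ˣ) : Matrix (Fin 3) (Fin 3) ℤ)ᵀ * J3 * _ = J3
  have h1 : A.1 * (A⁻¹).1 = 1 := A.mul_inv
  have h2 : ((A⁻¹).1)ᵀ * (A.1)ᵀ = 1 := by rw [← Matrix.transpose_mul, h1, Matrix.transpose_one]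
  calc ((A⁻¹).1)ᵀ * J3 * (A⁻¹).1
      = ((A⁻¹).1)ᵀ * ((A.1)ᵀ * J3 * A.1) * (A⁻¹).1 := by rw [hA']
    _ = (((A⁻¹).1)ᵀ * (A.1)ᵀ) * J3 * (A.1 * (A⁻¹).1) := by simp only [Matrix.mul_assoc]
    _ = J3 := by rw [h1, h2]; simp

lemma o12_neg {A : (Matrix (Fin 3) (Fin 3) ℤ)ˣ} (hA : A ∈ O12) : -A ∈ O12 := by
  have hA' : (A : Matrix (Fin 3) (Fin 3) ℤ)ᵀ * J3 * (A : Matrix (Fin 3) (Fin 3) ℤ) = J3 := hA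
  change ((-A : (Matrix (Fin 3) (Fin 3) ℤ)ˣ) : Matrix (Fin 3) (Fin 3) ℤ)ᵀ * J3 * _ = J3
  simp [hA']

/-- The row relation. -/
lemma o12_row {A : (Matrix (Fin 3) (Fin 3) ℤ)ˣ} (hA : A ∈ O12) :
    A.1 0 0 ^ 2 - A.1 0 1 ^ 2 - A.1 0 2 ^ 2 = 1 := by
  have hA' : (A : Matrix (Fin 3) (Fin 3) ℤ)ᵀ * J3 * (A : Matrix (Fin 3) (Fin 3) ℤ) = J3 := hA
  have hJ : J3 * J3 = 1 := by decide
  have h1 : (J3 * (A.1)ᵀ * J3) * A.1 = 1 := by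
    calc (J3 * (A.1)ᵀ * J3) * A.1 = J3 * ((A.1)ᵀ * J3 * A.1) := by simp only [Matrix.mul_assoc]
      _ = 1 := by rw [hA', hJ]
  have h2 := mul_eq_one_comm.mp h1
  have := congrFun (congrFun h2 0) 0
  simp [Matrix.mul_apply, Fin.sum_univ_three, J3, Matrix.diagonal] at this
  linarith

/-- The open future cone. -/
def InCone (u : Fin 3 → ℤ) : Prop := 0 < u 0 ∧ u 1 ^ 2 + u 2 ^ 2 < u 0 ^ 2

lemma cs_pos {a b c x y z : ℤ} (ha : 0 < a) (hx : 0 < x) (h1 : b ^ 2 + c ^ 2 < a ^ 2)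
    (h2 : y ^ 2 + z ^ 2 < x ^ 2) : 0 < a * x + (b * y + c * z) := by
  have h3 : (b * y + c * z) ^ 2 < (a * x) ^ 2 := by
    have e1 : (b * y + c * z) ^ 2 ≤ (b ^ 2 + c ^ 2) * (y ^ 2 + z ^ 2) := by
      nlinarith [sq_nonneg (b * z - c * y)]
    have e2 : (b ^ 2 + c ^ 2) * (y ^ 2 + z ^ 2) ≤ (b ^ 2 + c ^ 2) * x ^ 2 :=
      mul_le_mul_of_nonneg_left h2.le (by positivity)
    have e3 : (b ^ 2 + c ^ 2) * x ^ 2 < a ^ 2 * x ^ 2 :=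
      mul_lt_mul_of_pos_right h1 (by positivity)
    nlinarith
  have := abs_lt_of_sq_lt_sq h3 (by positivity)
  have := (abs_lt.mp this).1
  linarith

lemma InCone.add {u v : Fin 3 → ℤ} (hu : InCone u) (hv : InCone v) : InCone (u + v) := by
  obtain ⟨a, b⟩ := hu
  obtain ⟨c, d⟩ := hv
  have := cs_pos (b := - u 1) (c := - u 2) a c (by simpa using b) d
  refine ⟨by simp; linarith, ?_⟩
  simp only [Pi.add_apply]
  nlinarith

lemma o12_sign_mul {A B : (Matrix (Fin 3) (Fin 3) ℤ)ˣ} (hA : A ∈ O12) (hB : B ∈ O12) :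
    ((A * B).1 0 0).sign = (A.1 0 0).sign * (B.1 0 0).sign := by
  have h1 := o12_row hA
  have h2 := o12_entries hB 0 0
  have hJ : J3 0 0 = 1 := by decide
  rw [hJ] at h2
  have e : (A * B).1 0 0 = A.1 0 0 * B.1 0 0 + (A.1 0 1 * B.1 1 0 + A.1 0 2 * B.1 2 0) := by
    rw [Units.val_mul, Matrix.mul_apply, Fin.sum_univ_three]; ring
  rw [e]
  generalize A.1 0 0 = a at *
  generalize A.1 0 1 = b at *
  generalize A.1 0 2 = c at *
  generalize B.1 0 0 = x at *
  generalize B.1 1 0 = y at *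
  generalize B.1 2 0 = z at *
  have ha : a ≠ 0 := by rintro rfl; nlinarith [sq_nonneg b, sq_nonneg c]
  have hx : x ≠ 0 := by rintro rfl; nlinarith [sq_nonneg y, sq_nonneg z]
  rcases lt_or_gt_of_ne ha with ha | ha <;> rcases lt_or_gt_of_ne hx with hx | hx
  · rw [Int.sign_eq_neg_one_of_neg ha, Int.sign_eq_neg_one_of_neg hx, Int.sign_eq_one_of_pos]
    · rfl
    · have := cs_pos (a := -a) (x := -x) (b := b) (c := c) (y := y) (z := z)
        (by linarith) (by linarith) (by nlinarith) (by nlinarith)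
      linarith
  · rw [Int.sign_eq_neg_one_of_neg ha, Int.sign_eq_one_of_pos hx, Int.sign_eq_neg_one_of_neg]
    · rfl
    · have := cs_pos (a := -a) (x := x) (b := -b) (c := -c) (y := y) (z := z)
        (by linarith) (by linarith) (by nlinarith) (by nlinarith)
      linarith
  · rw [Int.sign_eq_one_of_pos ha, Int.sign_eq_neg_one_of_neg hx, Int.sign_eq_neg_one_of_neg]
    · rfl
    · have := cs_pos (a := a) (x := -x) (b := -b) (c := -c) (y := y) (z := z)
        (by linarith) (by linarith) (by nlinarith) (by nlinarith)
      linarith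
  · rw [Int.sign_eq_one_of_pos ha, Int.sign_eq_one_of_pos hx, Int.sign_eq_one_of_pos]
    · rfl
    · exact cs_pos ha hx (by nlinarith) (by nlinarith)

/-- A finite subgroup preserves some vector of the cone up to sign. -/
lemma exists_fixed (G : Subgroup (Matrix (Fin 3) (Fin 3) ℤ)ˣ)
    (hGsub : (G : Set (Matrix (Fin 3) (Fin 3) ℤ)ˣ) ⊆ O12)
    (hGfin : (G : Set (Matrix (Fin 3) (Fin 3) ℤ)ˣ).Finite) :
    ∃ v, InCone v ∧ ∀ A ∈ G, A.1 *ᵥ v = v ∨ A.1 *ᵥ v = -v := by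
  have : Finite G := hGfin
  have := Fintype.ofFinite G
  let f : G → (Fin 3 → ℤ) := fun g => (g.1.1 0 0).sign • (g.1.1).col 0
  refine ⟨∑ g, f g, ?_, ?_⟩
  · apply Finset.sum_induction_nonempty f InCone (fun _ _ => InCone.add)
      Finset.univ_nonempty
    intro g _
    have h := o12_entries (hGsub g.2) 0 0
    have hJ : J3 0 0 = 1 := by decide
    rw [hJ] at h
    have h0 : g.1.1 0 0 ≠ 0 := by
      intro h0
      rw [h0] at h
      nlinarith [sq_nonneg (g.1.1 1 0), sq_nonneg (g.1.1 2 0)]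
    have hs : ((g.1.1 0 0).sign) ^ 2 = 1 := by
      rcases lt_or_gt_of_ne h0 with h0 | h0
      · rw [Int.sign_eq_neg_one_of_neg h0]; rfl
      · rw [Int.sign_eq_one_of_pos h0]; rfl
    constructor
    · simp only [f, Pi.smul_apply, Matrix.col_apply, smul_eq_mul]
      rw [Int.sign_mul_self_eq_abs]
      exact abs_pos.mpr h0
    · simp only [f, Pi.smul_apply, Matrix.col_apply, smul_eq_mul, mul_pow, hs]
      nlinarith
  · intro A hA
    have key : A.1 *ᵥ (∑ g, f g) = (A.1 0 0).sign • ∑ g, f g := by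
      rw [Matrix.mulVec_sum, Finset.smul_sum,
        ← Equiv.sum_comp (Equiv.mulLeft (⟨A, hA⟩ : G)) (fun g => (A.1 0 0).sign • f g)]
      refine Finset.sum_congr rfl fun g _ => ?_
      have hm := o12_sign_mul (hGsub hA) (hGsub g.2)
      have hs : (A.1 0 0).sign * (A.1 0 0).sign = 1 := by
        have h1 := o12_row (hGsub hA)
        have h0 : A.1 0 0 ≠ 0 := by
          intro h0
          rw [h0] at h1
          nlinarith [sq_nonneg (A.1 0 1), sq_nonneg (A.1 0 2)]
        rcases lt_or_gt_of_ne h0 with h0 | h0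
        · rw [Int.sign_eq_neg_one_of_neg h0]; rfl
        · rw [Int.sign_eq_one_of_pos h0]; rfl
      have hc : (A.1 * g.1.1).col 0 = A.1 *ᵥ (g.1.1.col 0) := by
        ext i; simp [Matrix.mul_apply, Matrix.mulVec, dotProduct]
      simp only [f, Equiv.coe_mulLeft, Subgroup.coe_mul, hm]
      rw [Units.val_mul, hc, smul_smul, ← mul_assoc, hs, one_mul, Matrix.mulVec_smul]
    rw [key]
    rcases lt_trichotomy (A.1 0 0) 0 with h0 | h0 | h0
    · right; rw [Int.sign_eq_neg_one_of_neg h0]; simp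
    · exfalso
      have h1 := o12_row (hGsub hA)
      rw [h0] at h1
      nlinarith [sq_nonneg (A.1 0 1), sq_nonneg (A.1 0 2)]
    · left; rw [Int.sign_eq_one_of_pos h0]; simp

lemma o12_Q {A : (Matrix (Fin 3) (Fin 3) ℤ)ˣ} (hA : A ∈ O12) (u : Fin 3 → ℤ) :
    (A.1 *ᵥ u) 0 ^ 2 - (A.1 *ᵥ u) 1 ^ 2 - (A.1 *ᵥ u) 2 ^ 2 = u 0 ^ 2 - u 1 ^ 2 - u 2 ^ 2 := by
  have h00 := o12_entries hA 0 0
  have h01 := o12_entries hA 0 1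
  have h02 := o12_entries hA 0 2
  have h11 := o12_entries hA 1 1
  have h12 := o12_entries hA 1 2
  have h22 := o12_entries hA 2 2
  simp [J3, Matrix.diagonal] at h00 h01 h02 h11 h12 h22
  simp only [Matrix.mulVec, dotProduct, Fin.sum_univ_three]
  linear_combination u 0 ^ 2 * h00 + u 1 ^ 2 * h11 + u 2 ^ 2 * h22 + 2 * u 0 * u 1 * h01 +
    2 * u 0 * u 2 * h02 + 2 * u 1 * u 2 * h12

def refE1 : (Matrix (Fin 3) (Fin 3) ℤ)ˣ :=
  ⟨reflMat3 ![0, 1, 0], reflMat3 ![0, 1, 0], by decide, by decide⟩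

lemma refE1_mem : refE1 ∈ O12 := by
  change (reflMat3 ![0, 1, 0])ᵀ * J3 * reflMat3 ![0, 1, 0] = J3
  decide
lemma refE2_mem : refE2 ∈ O12 := by
  change (reflMat3 ![0, 0, 1])ᵀ * J3 * reflMat3 ![0, 0, 1] = J3
  decide
lemma refE1E2_mem : refE1E2 ∈ O12 := by
  change (reflMat3 ![0, 1, -1])ᵀ * J3 * reflMat3 ![0, 1, -1] = J3
  decide
lemma refHE1E2_mem : refHE1E2 ∈ O12 := by
  change (reflMat3 ![1, -1, -1])ᵀ * J3 * reflMat3 ![1, -1, -1] = J3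
  decide

lemma refE1_val : refE1.1 = !![1, 0, 0; 0, -1, 0; 0, 0, 1] := by decide
lemma refE2_val : refE2.1 = !![1, 0, 0; 0, 1, 0; 0, 0, -1] := by decide
lemma refE1E2_val : refE1E2.1 = !![1, 0, 0; 0, 0, 1; 0, 1, 0] := by decide
lemma refHE1E2_val : refHE1E2.1 = !![3, 2, 2; -2, -1, -2; -2, -2, -1] := by decide

/-- Reduction to the fundamental chamber. -/
lemma exists_reduced (v : Fin 3 → ℤ) (hv : InCone v) :
    ∃ h ∈ O12, InCone (h.1 *ᵥ v) ∧ (h.1 *ᵥ v) 1 ≤ 0 ∧ (h.1 *ᵥ v) 2 ≤ 0 ∧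
      0 ≤ (h.1 *ᵥ v) 0 + (h.1 *ᵥ v) 1 + (h.1 *ᵥ v) 2 := by
  have hcone : ∀ h ∈ O12, 0 < (h.1 *ᵥ v) 0 → InCone (h.1 *ᵥ v) := by
    intro h hh h0
    refine ⟨h0, ?_⟩
    have := o12_Q hh v
    have := hv.2
    linarith
  have hex : ∃ n : ℕ, ∃ h ∈ O12, 0 < (h.1 *ᵥ v) 0 ∧ (h.1 *ᵥ v) 0 = n :=
    ⟨(v 0).toNat, 1, o12_one, by simpa using hv.1, by
      have := hv.1
      simp; omega⟩
  classical
  have hmin := fun m (hm : m < Nat.find hex) => Nat.find_min hex hm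
  obtain ⟨h0, hh0, hp0, hn0⟩ := Nat.find_spec hex
  generalize Nat.find hex = n at *
  -- fix sign of coordinate 1
  obtain ⟨h1, hh1, hn1, hb1⟩ : ∃ h ∈ O12, (h.1 *ᵥ v) 0 = n ∧ (h.1 *ᵥ v) 1 ≤ 0 := by
    by_cases hb : (h0.1 *ᵥ v) 1 ≤ 0
    · exact ⟨h0, hh0, hn0, hb⟩
    · refine ⟨refE1 * h0, o12_mul refE1_mem hh0, ?_, ?_⟩ <;>
        rw [Units.val_mul, ← Matrix.mulVec_mulVec, refE1_val] <;>
        generalize h0.1 *ᵥ v = w at * <;>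
        simp [Matrix.mulVec, dotProduct, Fin.sum_univ_three] <;> omega
  obtain ⟨h2, hh2, hn2, hb2, hc2⟩ : ∃ h ∈ O12, (h.1 *ᵥ v) 0 = n ∧ (h.1 *ᵥ v) 1 ≤ 0 ∧
      (h.1 *ᵥ v) 2 ≤ 0 := by
    by_cases hb : (h1.1 *ᵥ v) 2 ≤ 0
    · exact ⟨h1, hh1, hn1, hb1, hb⟩
    · refine ⟨refE2 * h1, o12_mul refE2_mem hh1, ?_, ?_, ?_⟩ <;>
        rw [Units.val_mul, ← Matrix.mulVec_mulVec, refE2_val] <;>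
        generalize h1.1 *ᵥ v = w at * <;>
        simp [Matrix.mulVec, dotProduct, Fin.sum_univ_three] <;> omega
  have hc := hcone h2 hh2 (by omega)
  refine ⟨h2, hh2, hc, hb2, hc2, ?_⟩
  by_contra hneg
  have e : ((refHE1E2 * h2).1 *ᵥ v) 0 =
      3 * (h2.1 *ᵥ v) 0 + 2 * (h2.1 *ᵥ v) 1 + 2 * (h2.1 *ᵥ v) 2 := by
    rw [Units.val_mul, ← Matrix.mulVec_mulVec, refHE1E2_val]
    generalize h2.1 *ᵥ v = w at *
    simp [Matrix.mulVec, dotProduct, Fin.sum_univ_three]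
  have hpos : 0 < 3 * (h2.1 *ᵥ v) 0 + 2 * (h2.1 *ᵥ v) 1 + 2 * (h2.1 *ᵥ v) 2 := by
    have := cs_pos (a := 3) (b := 2) (c := 2) (by norm_num) hc.1 (by norm_num) hc.2
    linarith
  refine hmin (3 * (h2.1 *ᵥ v) 0 + 2 * (h2.1 *ᵥ v) 1 + 2 * (h2.1 *ᵥ v) 2).toNat ?_
    ⟨refHE1E2 * h2, o12_mul refHE1E2_mem hh2, ?_, ?_⟩
  · omega
  · omega
  · rw [e]; omega

/-- Elements fixing `H`. -/
lemma classify {A : (Matrix (Fin 3) (Fin 3) ℤ)ˣ} (hA : A ∈ O12) (h : A.1 0 0 = 1) :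
    ∃ x y : ℤ, (x = 1 ∨ x = -1) ∧ (y = 1 ∨ y = -1) ∧
      (A.1 = !![1, 0, 0; 0, x, 0; 0, 0, y] ∨ A.1 = !![1, 0, 0; 0, 0, x; 0, y, 0]) := by
  have h00 := o12_entries hA 0 0
  have h01 := o12_entries hA 0 1
  have h02 := o12_entries hA 0 2
  have h11 := o12_entries hA 1 1
  have h12 := o12_entries hA 1 2
  have h22 := o12_entries hA 2 2
  simp [J3, Matrix.diagonal] at h00 h01 h02 h11 h12 h22
  rw [h] at h00 h01 h02
  have hq : A.1 1 0 = 0 := by nlinarith [sq_nonneg (A.1 1 0), sq_nonneg (A.1 2 0)]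
  have hr : A.1 2 0 = 0 := by nlinarith [sq_nonneg (A.1 1 0), sq_nonneg (A.1 2 0)]
  rw [hq, hr] at h01 h02
  have h3 : A.1 0 1 = 0 := by linarith
  have h4 : A.1 0 2 = 0 := by linarith
  rw [h3] at h11 h12
  rw [h4] at h22 h12
  have eA : A.1 = !![A.1 0 0, A.1 0 1, A.1 0 2; A.1 1 0, A.1 1 1, A.1 1 2;
      A.1 2 0, A.1 2 1, A.1 2 2] := Matrix.eta_fin_three A.1
  rw [h, h3, h4, hq, hr] at eA
  rw [eA]
  clear eA
  generalize A.1 1 1 = a at *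
  generalize A.1 1 2 = b at *
  generalize A.1 2 1 = c at *
  generalize A.1 2 2 = d at *
  have ha : a = 0 ∨ a = 1 ∨ a = -1 := by
    have : a ≤ 1 := by nlinarith
    have : -1 ≤ a := by nlinarith
    omega
  have hb : b = 0 ∨ b = 1 ∨ b = -1 := by
    have : b ≤ 1 := by nlinarith
    have : -1 ≤ b := by nlinarith
    omega
  have hc : c = 0 ∨ c = 1 ∨ c = -1 := by
    have : c ≤ 1 := by nlinarith
    have : -1 ≤ c := by nlinarith
    omega
  have hd : d = 0 ∨ d = 1 ∨ d = -1 := by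
    have : d ≤ 1 := by nlinarith
    have : -1 ≤ d := by nlinarith
    omega
  by_cases ha0 : a = 0
  · have hd0 : d = 0 := by
      rcases hb with rfl | rfl | rfl <;> rcases hc with rfl | rfl | rfl <;> subst ha0 <;> omega
    subst ha0 hd0
    exact ⟨b, c, by rcases hb with rfl | h | h <;> omega, by rcases hc with rfl | h | h <;> omega,
      Or.inr rfl⟩
  · have hb0 : b = 0 := by
      rcases ha with rfl | rfl | rfl <;> rcases hc with rfl | rfl | rfl <;>
        rcases hb with rfl | rfl | rfl <;> omega
    have hc0 : c = 0 := by
      subst hb0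
      rcases ha with rfl | rfl | rfl <;> rcases hc with rfl | rfl | rfl <;> omega
    subst hb0 hc0
    exact ⟨a, d, by omega, by rcases hd with rfl | h | h <;> omega, Or.inl rfl⟩

abbrev K1 : Subgroup (Matrix (Fin 3) (Fin 3) ℤ)ˣ := Subgroup.closure {refE1E2, refE2, -1}
abbrev K2 : Subgroup (Matrix (Fin 3) (Fin 3) ℤ)ˣ := Subgroup.closure {refHE1E2, refE1E2, -1}

lemma mem_K1 {A : (Matrix (Fin 3) (Fin 3) ℤ)ˣ} (hA : A ∈ O12) (h : A.1 0 0 = 1) : A ∈ K1 := by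
  have t : refE1E2 ∈ K1 := Subgroup.subset_closure (by simp)
  have s : refE2 ∈ K1 := Subgroup.subset_closure (by simp)
  have u : refE1E2 * refE2 * refE1E2 ∈ K1 := mul_mem (mul_mem t s) t
  obtain ⟨x, y, hx | hx, hy | hy, e | e⟩ := classify hA h <;> subst hx hy
  · rw [show A = 1 from Units.ext (by rw [e]; decide)]; exact one_mem _
  · rw [show A = refE1E2 from Units.ext (by rw [e]; decide)]; exact t
  · rw [show A = refE2 from Units.ext (by rw [e]; decide)]; exact s
  · rw [show A = refE2 * refE1E2 from Units.ext (by rw [e]; decide)]; exact mul_mem s t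
  · rw [show A = refE1E2 * refE2 * refE1E2 from Units.ext (by rw [e]; decide)]; exact u
  · rw [show A = refE1E2 * refE2 from Units.ext (by rw [e]; decide)]; exact mul_mem t s
  · rw [show A = refE2 * (refE1E2 * refE2 * refE1E2) from Units.ext (by rw [e]; decide)]
    exact mul_mem s u
  · rw [show A = refE1E2 * refE2 * (refE1E2 * refE2 * refE1E2) from
      Units.ext (by rw [e]; decide)]
    exact mul_mem (mul_mem t s) u

lemma stab_cases {A : (Matrix (Fin 3) (Fin 3) ℤ)ˣ} (hA : A ∈ O12) {w : Fin 3 → ℤ}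
    (hw : InCone w) (hb : w 1 ≤ 0) (hc : w 2 ≤ 0) (ha : 0 ≤ w 0 + w 1 + w 2)
    (hfix : A.1 *ᵥ w = w) :
    A.1 0 0 = 1 ∨ (w 0 + w 1 + w 2 = 0 ∧ A.1 0 0 = 3 ∧ A.1 1 0 = -2 ∧ A.1 2 0 = -2) := by
  have h00 := o12_entries hA 0 0
  have h01 := o12_entries hA 0 1
  have h02 := o12_entries hA 0 2
  simp [J3, Matrix.diagonal] at h00 h01 h02
  have f0 := congrFun hfix 0
  have f1 := congrFun hfix 1
  have f2 := congrFun hfix 2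
  simp only [Matrix.mulVec, dotProduct, Fin.sum_univ_three] at f0 f1 f2
  have key : A.1 0 0 * w 0 - A.1 1 0 * w 1 - A.1 2 0 * w 2 = w 0 := by
    linear_combination (-A.1 0 0) * f0 + A.1 1 0 * f1 + A.1 2 0 * f2 + w 0 * h00 + w 1 * h01 +
      w 2 * h02
  obtain ⟨hw0, hw1⟩ := hw
  clear h01 h02 f0 f1 f2 hfix
  generalize A.1 0 0 = p at *
  generalize A.1 1 0 = q0 at *
  generalize A.1 2 0 = r0 at *
  generalize w 0 = a at *
  generalize w 1 = b at *
  generalize w 2 = c at *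
  obtain ⟨B, rfl⟩ : ∃ B, b = -B := ⟨-b, by ring⟩
  obtain ⟨C, rfl⟩ : ∃ C, c = -C := ⟨-c, by ring⟩
  obtain ⟨q, rfl⟩ : ∃ q, q0 = -q := ⟨-q0, by ring⟩
  obtain ⟨r, rfl⟩ : ∃ r, r0 = -r := ⟨-r0, by ring⟩
  have hB0 : 0 ≤ B := by omega
  have hC0 : 0 ≤ C := by omega
  have hp0 : p ≠ 0 := by rintro rfl; nlinarith
  rcases lt_or_gt_of_ne hp0 with hp | hp
  · exfalso
    have q1 : p + 1 ≤ q := by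
      by_contra hh
      nlinarith
    have r1 : p + 1 ≤ r := by
      by_contra hh
      nlinarith
    nlinarith [mul_nonneg (sub_nonneg.2 q1) hB0, mul_nonneg (sub_nonneg.2 r1) hC0,
      mul_nonneg (by linarith : 0 ≤ -(p + 1)) ha]
  · have q1 : q ≤ p - 1 := by
      by_contra hh
      nlinarith
    have r1 : r ≤ p - 1 := by
      by_contra hh
      nlinarith
    have m1 := mul_nonneg (sub_nonneg.2 q1) hB0
    have m2 := mul_nonneg (sub_nonneg.2 r1) hC0
    have m3 := mul_nonneg (by linarith : 0 ≤ p - 1) ha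
    by_cases hp1 : p = 1
    · left; exact hp1
    right
    have z3 : (p - 1) * (a + -B + -C) = 0 := by nlinarith
    have z1 : (p - 1 - q) * B = 0 := by nlinarith
    have z2 : (p - 1 - r) * C = 0 := by nlinarith
    have ea : a + -B + -C = 0 := by
      rcases mul_eq_zero.mp z3 with h | h
      · omega
      · exact h
    have hBn : B ≠ 0 := by rintro rfl; nlinarith
    have hCn : C ≠ 0 := by rintro rfl; nlinarith
    have eq1 : q = p - 1 := by
      rcases mul_eq_zero.mp z1 with h | h
      · omega
      · exact absurd h hBn
    have er1 : r = p - 1 := by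
      rcases mul_eq_zero.mp z2 with h | h
      · omega
      · exact absurd h hCn
    have hp3 : (p - 1) * (p - 3) = 0 := by
      subst eq1 er1
      linarith
    have : p = 3 := by
      rcases mul_eq_zero.mp hp3 with h | h
      · omega
      · omega
    exact ⟨ea, by omega, by omega, by omega⟩

lemma mem_K2_aux {A : (Matrix (Fin 3) (Fin 3) ℤ)ˣ} (hA : A ∈ O12) (h : A.1 0 0 = 1)
    {w : Fin 3 → ℤ} (hb : w 1 < 0) (hc : w 2 < 0) (hfix : A.1 *ᵥ w = w) : A ∈ K2 := by
  have t : refE1E2 ∈ K2 := Subgroup.subset_closure (by simp)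
  have f1 := congrFun hfix 1
  have f2 := congrFun hfix 2
  obtain ⟨x, y, hx | hx, hy | hy, e | e⟩ := classify hA h <;> subst hx hy <;>
    rw [e] at f1 f2 <;> simp [Matrix.mulVec, dotProduct, Fin.sum_univ_three] at f1 f2 <;>
    first
    | (exfalso; omega)
    | (rw [show A = 1 from Units.ext (by rw [e]; decide)]; exact one_mem _)
    | (rw [show A = refE1E2 from Units.ext (by rw [e]; decide)]; exact t)

lemma mem_K2 {A : (Matrix (Fin 3) (Fin 3) ℤ)ˣ} (hA : A ∈ O12) {w : Fin 3 → ℤ}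
    (hw : InCone w) (hb : w 1 ≤ 0) (hc : w 2 ≤ 0) (ha : w 0 + w 1 + w 2 = 0)
    (hfix : A.1 *ᵥ w = w) : A ∈ K2 := by
  obtain ⟨hw0, hw1⟩ := id hw
  have e0 : w 0 = - w 1 - w 2 := by omega
  have hb' : w 1 < 0 := by
    refine lt_of_le_of_ne hb fun h => ?_
    rw [e0, h] at hw1; nlinarith
  have hc' : w 2 < 0 := by
    refine lt_of_le_of_ne hc fun h => ?_
    rw [e0, h] at hw1; nlinarith
  rcases stab_cases hA hw hb hc ha.ge hfix with h | ⟨-, h3, h1, h2⟩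
  · exact mem_K2_aux hA h hb' hc' hfix
  · have s : refHE1E2 ∈ K2 := Subgroup.subset_closure (by simp)
    have : refHE1E2 * A ∈ K2 := by
      refine mem_K2_aux (w := w) (o12_mul refHE1E2_mem hA) ?_ hb' hc' ?_
      · rw [Units.val_mul, refHE1E2_val]
        simp [Matrix.mul_apply, Fin.sum_univ_three, h1, h2, h3]
      · rw [Units.val_mul, ← Matrix.mulVec_mulVec, hfix, refHE1E2_val]
        ext i
        fin_cases i <;> simp [Matrix.mulVec, dotProduct, Fin.sum_univ_three] <;> omega
    exact (Subgroup.mul_mem_cancel_left _ s).mp this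

lemma K1_sub : (K1 : Set (Matrix (Fin 3) (Fin 3) ℤ)ˣ) ⊆ O12 := by
  intro A hA
  induction hA using Subgroup.closure_induction with
  | mem x hx =>
    rcases hx with rfl | rfl | rfl
    · exact refE1E2_mem
    · exact refE2_mem
    · exact o12_neg o12_one
  | one => exact o12_one
  | mul x y _ _ hx hy => exact o12_mul hx hy
  | inv x _ hx => exact o12_inv hx

lemma K2_sub : (K2 : Set (Matrix (Fin 3) (Fin 3) ℤ)ˣ) ⊆ O12 := by
  intro A hA
  induction hA using Subgroup.closure_induction with
  | mem x hx =>
    rcases hx with rfl | rfl | rfl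
    · exact refHE1E2_mem
    · exact refE1E2_mem
    · exact o12_neg o12_one
  | one => exact o12_one
  | mul x y _ _ hx hy => exact o12_mul hx hy
  | inv x _ hx => exact o12_inv hx

/-- A finite set containing `1` and stable under left multiplication by involutive generators
contains the closure. -/
lemma closure_fin (S : Set (Matrix (Fin 3) (Fin 3) ℤ)ˣ) (T : Finset (Matrix (Fin 3) (Fin 3) ℤ))
    (h1 : 1 ∈ T) (hS : ∀ s ∈ S, s⁻¹ = s ∧ ∀ x ∈ T, s.1 * x ∈ T) :
    (Subgroup.closure S : Set (Matrix (Fin 3) (Fin 3) ℤ)ˣ).Finite := by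
  have : ∀ A ∈ Subgroup.closure S, A.1 ∈ T := by
    intro A hA
    induction hA using Subgroup.closure_induction_left with
    | one => exact h1
    | mul_left x hx y _ ih => exact (hS x hx).2 _ ih
    | inv_mul_cancel x hx y _ ih => rw [(hS x hx).1]; exact (hS x hx).2 _ ih
  refine Set.Finite.of_finite_image (f := Units.val) (T.finite_toSet.subset ?_)
    Units.val_injective.injOn
  rintro _ ⟨A, hA, rfl⟩
  exact this A hA

def T1 : Finset (Matrix (Fin 3) (Fin 3) ℤ) :=
  (({1, -1} ×ˢ {1, -1} ×ˢ {1, -1} : Finset (ℤ × ℤ × ℤ)).image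
    fun p => !![p.1, 0, 0; 0, p.2.1, 0; 0, 0, p.2.2]) ∪
  (({1, -1} ×ˢ {1, -1} ×ˢ {1, -1} : Finset (ℤ × ℤ × ℤ)).image
    fun p => !![p.1, 0, 0; 0, 0, p.2.1; 0, p.2.2, 0])

def T2 : Finset (Matrix (Fin 3) (Fin 3) ℤ) :=
  {1, refHE1E2.1, refE1E2.1, refHE1E2.1 * refE1E2.1,
    -1, -refHE1E2.1, -refE1E2.1, -(refHE1E2.1 * refE1E2.1)}

lemma K1_fin : (K1 : Set (Matrix (Fin 3) (Fin 3) ℤ)ˣ).Finite := by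
  apply closure_fin _ T1 (by decide +kernel)
  rintro s (rfl | rfl | rfl)
  · exact ⟨rfl, by decide +kernel⟩
  · exact ⟨rfl, by decide +kernel⟩
  · exact ⟨by simp, by decide +kernel⟩

lemma K2_fin : (K2 : Set (Matrix (Fin 3) (Fin 3) ℤ)ˣ).Finite := by
  apply closure_fin _ T2 (by decide +kernel)
  rintro s (rfl | rfl | rfl)
  · exact ⟨rfl, by decide +kernel⟩
  · exact ⟨rfl, by decide +kernel⟩
  · exact ⟨by simp, by decide +kernel⟩

/-- The conclusion once a conjugate of `G` lies in `K`. -/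
lemma finish (G K : Subgroup (Matrix (Fin 3) (Fin 3) ℤ)ˣ)
    (hGmax : ∀ G' : Subgroup (Matrix (Fin 3) (Fin 3) ℤ)ˣ,
      (G' : Set (Matrix (Fin 3) (Fin 3) ℤ)ˣ) ⊆ O12 →
      (G' : Set (Matrix (Fin 3) (Fin 3) ℤ)ˣ).Finite → G ≤ G' → G = G')
    (hK : (K : Set (Matrix (Fin 3) (Fin 3) ℤ)ˣ) ⊆ O12)
    (hKf : (K : Set (Matrix (Fin 3) (Fin 3) ℤ)ˣ).Finite)
    {h : (Matrix (Fin 3) (Fin 3) ℤ)ˣ} (hh : h ∈ O12) (hc : ∀ A ∈ G, h * A * h⁻¹ ∈ K) :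
    G = Subgroup.map (MulAut.conj h⁻¹).toMonoidHom K := by
  apply hGmax
  · rintro _ ⟨k, hk, rfl⟩
    simp only [MulEquiv.coe_toMonoidHom, MulAut.conj_apply]
    exact o12_mul (o12_mul (o12_inv hh) (hK hk)) (o12_inv (o12_inv hh))
  · rw [Subgroup.coe_map]
    exact hKf.image _
  · intro A hA
    refine ⟨h * A * h⁻¹, hc A hA, ?_⟩
    simp only [MulEquiv.coe_toMonoidHom, MulAut.conj_apply]
    group

/-- Every maximal finite subgroup of `O(1,2)(ℤ)` is conjugate in `O(1,2)(ℤ)` to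
`⟨Ref_{E₁−E₂}, Ref_{E₂}, −I₃⟩` or to `⟨Ref_{H−E₁−E₂}, Ref_{E₁−E₂}, −I₃⟩`. -/
theorem max_finite_subgroups_O12 (G : Subgroup (Matrix (Fin 3) (Fin 3) ℤ)ˣ)
    (hGsub : (G : Set (Matrix (Fin 3) (Fin 3) ℤ)ˣ) ⊆ O12)
    (hGfin : (G : Set (Matrix (Fin 3) (Fin 3) ℤ)ˣ).Finite)
    (hGmax : ∀ G' : Subgroup (Matrix (Fin 3) (Fin 3) ℤ)ˣ,
      (G' : Set (Matrix (Fin 3) (Fin 3) ℤ)ˣ) ⊆ O12 →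
      (G' : Set (Matrix (Fin 3) (Fin 3) ℤ)ˣ).Finite → G ≤ G' → G = G') :
    ∃ g ∈ O12,
      G = Subgroup.map (MulAut.conj g).toMonoidHom
            (Subgroup.closure {refE1E2, refE2, -1}) ∨
      G = Subgroup.map (MulAut.conj g).toMonoidHom
            (Subgroup.closure {refHE1E2, refE1E2, -1}) := by
  obtain ⟨v, hv, hfix⟩ := exists_fixed G hGsub hGfin
  obtain ⟨h, hh, hw, hb, hc, ha⟩ := exists_reduced v hv
  refine ⟨h⁻¹, o12_inv hh, ?_⟩
  have hconj : ∀ A ∈ G, h * A * h⁻¹ ∈ O12 := fun A hA =>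
    o12_mul (o12_mul hh (hGsub hA)) (o12_inv hh)
  have hact : ∀ A : (Matrix (Fin 3) (Fin 3) ℤ)ˣ,
      (h * A * h⁻¹).1 *ᵥ (h.1 *ᵥ v) = h.1 *ᵥ (A.1 *ᵥ v) := by
    intro A
    rw [Matrix.mulVec_mulVec, Matrix.mulVec_mulVec, ← Units.val_mul, ← Units.val_mul,
      inv_mul_cancel_right]
  -- up to sign, conjugated elements fix the reduced vector
  have hred : ∀ K : Subgroup (Matrix (Fin 3) (Fin 3) ℤ)ˣ, -1 ∈ K →
      (∀ B ∈ O12, B.1 *ᵥ (h.1 *ᵥ v) = h.1 *ᵥ v → B ∈ K) → ∀ A ∈ G, h * A * h⁻¹ ∈ K := by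
    intro K hK hB A hA
    rcases hfix A hA with e | e
    · exact hB _ (hconj A hA) (by rw [hact, e])
    · have : -(h * A * h⁻¹) ∈ K := by
        refine hB _ (o12_neg (hconj A hA)) ?_
        rw [Units.val_neg, Matrix.neg_mulVec, hact, e, Matrix.mulVec_neg, neg_neg]
      have h2 := mul_mem hK this
      simpa using h2
  by_cases h0 : (h.1 *ᵥ v) 0 + (h.1 *ᵥ v) 1 + (h.1 *ᵥ v) 2 = 0
  · right
    exact finish G K2 hGmax K2_sub K2_fin hh
      (hred K2 (Subgroup.subset_closure (by simp)) fun B hB e => mem_K2 hB hw hb hc h0 e)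
  · left
    refine finish G K1 hGmax K1_sub K1_fin hh
      (hred K1 (Subgroup.subset_closure (by simp)) fun B hB e => ?_)
    rcases stab_cases hB hw hb hc ha e with h1 | ⟨h1, -⟩
    · exact mem_K1 hB h1
    · exact absurd h1 h0
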